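/- ∫₀^∞ sinh(u)/(u · cosh⁵(u)) du = (1/(3π²))·(7ζ(3) + 93ζ(5)/π²), where ζ is the Riemann zeta function. -/

import Mathlib

open Complex Set in
lemma iter_step {f g g' : ℂ → ℂ} {k : ℕ}
    (h : EqOn (iteratedDerivWithin k f UpperHalfPlane.upperHalfPlaneSet) g UpperHalfPlane.upperHalfPlaneSet)
    (hg : ∀ z ∈ UpperHalfPlane.upperHalfPlaneSet, HasDerivAt g (g' z) z) :
    EqOn (iteratedDerivWithin (k+1) f UpperHalfPlane.upperHalfPlaneSet) g' UpperHalfPlane.upperHalfPlaneSet := by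
  intro z hz
  rw [iteratedDerivWithin_succ, derivWithin_congr h (h hz)]
  exact (hg z hz).hasDerivWithinAt.derivWithin (UpperHalfPlane.isOpen_upperHalfPlaneSet.uniqueDiffWithinAt hz)

lemma hasDeriv_cot {z : ℂ} (hz : z ∈ UpperHalfPlane.upperHalfPlaneSet) :
    HasDerivAt (fun z : ℂ => Complex.cot (Real.pi * z)) (-(Real.pi * (1 + Complex.cot (Real.pi * z)^2))) z := by
  have hs : Complex.sin (Real.pi * z) ≠ 0 := by
    intro h
    rw [Complex.sin_eq_zero_iff] at h
    obtain ⟨k, hk⟩ := h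
    have hpi : (Real.pi : ℂ) ≠ 0 := by exact_mod_cast Real.pi_ne_zero
    have : z = k := mul_left_cancel₀ hpi (by rw [hk]; ring)
    have h2 : 0 < z.im := hz
    rw [this] at h2
    simp at h2
  have hl : HasDerivAt (fun z : ℂ => (Real.pi : ℂ) * z) Real.pi z := by
    simpa using (hasDerivAt_id z).const_mul (Real.pi : ℂ)
  have := ((Complex.hasDerivAt_cos _).comp z hl).div ((Complex.hasDerivAt_sin _).comp z hl) hs
  simp only [Complex.cot_eq_cos_div_sin]
  refine this.congr_deriv ?_
  simp only [Function.comp]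
  field_simp
  ring

lemma iter_cot {z : ℂ} (hz : z ∈ UpperHalfPlane.upperHalfPlaneSet) :
    iteratedDerivWithin 2 (fun x : ℂ ↦ Real.pi * Complex.cot (Real.pi * x)) UpperHalfPlane.upperHalfPlaneSet z
      = 2 * Real.pi ^ 3 * (Complex.cot (Real.pi * z) + Complex.cot (Real.pi * z)^3) ∧
    iteratedDerivWithin 4 (fun x : ℂ ↦ Real.pi * Complex.cot (Real.pi * x)) UpperHalfPlane.upperHalfPlaneSet z
      = 8 * Real.pi ^ 5 * (2 * Complex.cot (Real.pi * z) + 3 * Complex.cot (Real.pi * z)^3) * (1 + Complex.cot (Real.pi * z)^2) := by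
  have h0 : Set.EqOn (iteratedDerivWithin 0 (fun x : ℂ ↦ Real.pi * Complex.cot (Real.pi * x)) UpperHalfPlane.upperHalfPlaneSet) (fun x : ℂ ↦ Real.pi * Complex.cot (Real.pi * x)) UpperHalfPlane.upperHalfPlaneSet := by
    intro z _; simp
  have h1 := iter_step (g' := fun z => -Real.pi^2 * (1 + Complex.cot (Real.pi * z)^2)) h0 (fun z hz => by
    refine HasDerivAt.congr_deriv ((hasDeriv_cot hz).const_mul (Real.pi : ℂ)) ?_; push_cast; ring)
  have h2 := iter_step (g' := fun z => 2 * Real.pi^3 * (Complex.cot (Real.pi * z) + Complex.cot (Real.pi * z)^3)) h1 (fun z hz => by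
    refine HasDerivAt.congr_deriv ((((hasDeriv_cot hz).pow 2).const_add 1).const_mul (-(Real.pi : ℂ)^2)) ?_; push_cast; ring)
  have h3 := iter_step (g' := fun z => -2 * Real.pi^4 * (1 + 4 * Complex.cot (Real.pi * z)^2 + 3 * Complex.cot (Real.pi * z)^4)) h2 (fun z hz => by
    refine HasDerivAt.congr_deriv (((hasDeriv_cot hz).add ((hasDeriv_cot hz).pow 3)).const_mul (2 * (Real.pi : ℂ)^3)) ?_; push_cast; ring)
  have h4 := iter_step (g' := fun z => 8 * Real.pi ^ 5 * (2 * Complex.cot (Real.pi * z) + 3 * Complex.cot (Real.pi * z)^3) * (1 + Complex.cot (Real.pi * z)^2)) h3 (fun z hz => by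
    refine HasDerivAt.congr_deriv ((((((hasDeriv_cot hz).pow 2).const_mul 4).const_add 1).add (((hasDeriv_cot hz).pow 4).const_mul 3)).const_mul (-2 * (Real.pi : ℂ)^4)) ?_; push_cast; ring)
  exact ⟨h2 hz, h4 hz⟩

noncomputable def GG (b v : ℝ) : ℝ :=
  (5*b^4-10*b^2*v^2+v^4)/(b^2+v^2)^5 + Real.pi^2/3 * ((3*b^2-v^2)/(b^2+v^2)^3)

lemma GG_even (b v : ℝ) : GG (-b) v = GG b v := by
  unfold GG; congr 2 <;> ring

lemma im_term (b v : ℝ) (hv : 0 < v) :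
    (1 / ((b:ℂ) + v * Complex.I)^5 + Real.pi^2/3 * (1 / ((b:ℂ) + v * Complex.I)^3)).im = -(v * GG b v) := by
  have hD : b^2+v^2 ≠ 0 := by positivity
  have hDc : (b:ℂ)^2+(v:ℂ)^2 ≠ 0 := by exact_mod_cast hD
  have key : 1 / ((b:ℂ) + v * Complex.I)
      = ((b:ℂ) - v * Complex.I) / (b^2+v^2) := by
    have h1 : ((b:ℂ) + v * Complex.I) * ((b:ℂ) - v * Complex.I) = b^2+v^2 := by
      ring_nf; rw [Complex.I_sq]; ring
    have h2 : (b:ℂ) + v * Complex.I ≠ 0 := by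
      intro h; rw [h, zero_mul] at h1; exact hDc h1.symm
    rw [← h1] at hDc
    rw [← h1]
    field_simp [right_ne_zero_of_mul hDc]
  have h5 : 1 / ((b:ℂ) + v * Complex.I)^5 + Real.pi^2/3 * (1 / ((b:ℂ) + v * Complex.I)^3)
     = (((b^5 - 10*b^3*v^2 + 5 * b*v^4)/(b^2+v^2)^5 + Real.pi^2/3 * ((b^3 - 3*b*v^2)/(b^2+v^2)^3) : ℝ) : ℂ)
       + ((-(v * GG b v) : ℝ) : ℂ) * Complex.I := by
    rw [← one_div_pow, ← one_div_pow, key, div_pow, div_pow]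
    unfold GG
    push_cast
    have e5 : ((b:ℂ) - v * Complex.I)^5 = (b^5 - 10*b^3*v^2 + 5 * b*v^4) - (v * (5*b^4-10*b^2*v^2+v^4)) * Complex.I := by
      have h3 : Complex.I^3 = -Complex.I := Complex.I_pow_three
      have h4 : Complex.I^4 = 1 := Complex.I_pow_four
      have h5 : Complex.I^5 = Complex.I := by rw [pow_succ, h4, one_mul]
      ring_nf; rw [h3, h4, h5, Complex.I_sq]; ring
    have e3 : ((b:ℂ) - v * Complex.I)^3 = (b^3 - 3*b*v^2) - (v * (3*b^2-v^2)) * Complex.I := by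
      have h3 : Complex.I^3 = -Complex.I := Complex.I_pow_three
      ring_nf; rw [h3, Complex.I_sq]; ring
    rw [e5, e3]
    ring
  rw [h5, Complex.add_im, Complex.im_ofReal_mul, Complex.ofReal_im, Complex.I_im]
  ring

lemma hasSum_GG (v : ℝ) (hv : 0 < v) :
    HasSum (fun n : ℕ => 2 / Real.pi^5 * GG (n + 1/2) v)
      (Real.sinh (Real.pi * v) / (v * Real.cosh (Real.pi * v)^5)) := by
  have hpi : (Real.pi : ℂ) ≠ 0 := by exact_mod_cast Real.pi_ne_zero
  set z : ℂ := 1/2 + v * Complex.I with hzdef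
  have hz : z ∈ UpperHalfPlane.upperHalfPlaneSet := by
    change 0 < z.im
    simp [hzdef, hv]
  obtain ⟨i2, i4⟩ := iter_cot hz
  rw [iteratedDerivWithin_cot_pi_mul_eq_mul_tsum_div_pow (by norm_num) hz] at i2 i4
  have s3 : Summable (fun n : ℤ => 1 / (z + n)^3) := by
    simpa using EisensteinSeries.linear_right_summable z 1 (k := (3:ℕ)) (by norm_num)
  have s5 : Summable (fun n : ℤ => 1 / (z + n)^5) := by
    simpa using EisensteinSeries.linear_right_summable z 1 (k := (5:ℕ)) (by norm_num)
  have hs := s5.hasSum.add (s3.hasSum.mul_left ((Real.pi:ℂ)^2/3))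
  have hs' := Complex.hasSum_im hs
  have hcosh : Real.cosh (Real.pi * v) ≠ 0 := (Real.cosh_pos _).ne'
  have hc : Complex.cot (Real.pi * z) = ((-(Real.sinh (Real.pi * v) / Real.cosh (Real.pi*v)) : ℝ) : ℂ) * Complex.I := by
    have : (Real.pi : ℂ) * z = ((Real.pi * v : ℝ) : ℂ) * Complex.I + Real.pi / 2 := by
      rw [hzdef]; push_cast; ring
    rw [Complex.cot_eq_cos_div_sin, this, Complex.sin_add_pi_div_two, Complex.cos_add_pi_div_two,
      Complex.sin_mul_I, Complex.cos_mul_I, ← Complex.ofReal_sinh, ← Complex.ofReal_cosh]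
    push_cast; ring
  set T := Real.sinh (Real.pi * v) / Real.cosh (Real.pi*v) with hT
  rw [hc] at i2 i4
  have hfin : (∑' n : ℤ, 1 / (z + n)^5) + (Real.pi:ℂ)^2/3 * (∑' n : ℤ, 1 / (z + n)^3)
      = ((-(Real.pi^5 * (T * (1 - T^2)^2)) : ℝ) : ℂ) * Complex.I := by
    norm_num [Nat.factorial] at i2 i4
    have a2 : (∑' n : ℤ, 1 / (z + n)^3) = Real.pi^3 * (-(T * Complex.I) + (-(T*Complex.I))^3) := by
      norm_num
      linear_combination i2/2
    have a4 : (∑' n : ℤ, 1 / (z + n)^5) = Real.pi^5/3 * (-(2 * (T * Complex.I)) + 3 * (-(T*Complex.I))^3) * (1 + (T * Complex.I)^2) := by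
      norm_num
      linear_combination i4/24
    rw [a2, a4]
    have h3 : Complex.I^3 = -Complex.I := Complex.I_pow_three
    have h4 : Complex.I^4 = 1 := Complex.I_pow_four
    have h5 : Complex.I^5 = Complex.I := by rw [pow_succ, h4, one_mul]
    push_cast
    ring_nf
    simp only [h3, h5]
    ring
  rw [hfin] at hs'
  have hs2 := hs'.mul_left (-1/(Real.pi^5 * v))
  have hs3 := hs2.nat_add_neg_add_one
  convert! hs3 using 1
  · funext n
    have t1 : z + ((n : ℤ) : ℂ) = (((n:ℝ) + 1/2 : ℝ) : ℂ) + v * Complex.I := by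
      rw [hzdef]; push_cast; ring
    have t2 : z + ((-((n : ℤ)+1) : ℤ) : ℂ) = ((-((n:ℝ) + 1/2) : ℝ) : ℂ) + v * Complex.I := by
      rw [hzdef]; push_cast; ring
    rw [t1, t2, im_term _ _ hv, im_term _ _ hv, GG_even]
    field_simp
    ring
  · have hsq : 1 - T^2 = 1 / Real.cosh (Real.pi * v)^2 := by
      rw [hT]
      field_simp
      linarith [Real.cosh_sq (Real.pi * v)]
    rw [hsq]
    simp only [Complex.mul_im, Complex.ofReal_re, Complex.ofReal_im, Complex.I_im, Complex.I_re]
    rw [hT]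
    field_simp
    ring

lemma GG_bound (b v : ℝ) (hb : 1/2 ≤ b) : |GG b v| ≤ 1000 * (1/b^2) * (1+v^2)⁻¹ := by
  have hb0 : 0 < b := by linarith
  have hD : 0 < b^2+v^2 := by positivity
  have hpi : Real.pi^2/3 ≤ 6 := by
    nlinarith [Real.pi_lt_four, Real.pi_pos]
  have hb2 : 1/4 ≤ b^2 := by nlinarith
  have hD4 : 1/4 * (1+v^2) ≤ b^2+v^2 := by nlinarith [sq_nonneg v]
  have hD1 : 1/4 ≤ b^2+v^2 := by nlinarith [sq_nonneg v]
  have e1 : |(5*b^4-10*b^2*v^2+v^4)/(b^2+v^2)^5| ≤ 40 / (b^2+v^2)^2 := by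
    rw [abs_div, abs_of_pos (pow_pos hD 5), div_le_div_iff₀ (by positivity) (by positivity)]
    have : |5*b^4-10*b^2*v^2+v^4| ≤ 10 * (b^2+v^2)^2 := by
      rw [abs_le]; constructor <;> nlinarith [sq_nonneg (b^2), sq_nonneg (v^2), mul_nonneg (sq_nonneg b) (sq_nonneg v)]
    calc _ ≤ 10 * (b^2+v^2)^2 * (b^2+v^2)^2 := by gcongr
      _ = 40 * ((b^2+v^2)^4 * (1/4)) := by ring
      _ ≤ 40 * ((b^2+v^2)^4 * (b^2+v^2)) := by gcongr
      _ = _ := by ring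
  have e2 : |(3*b^2-v^2)/(b^2+v^2)^3| ≤ 3 / (b^2+v^2)^2 := by
    rw [abs_div, abs_of_pos (pow_pos hD 3), div_le_div_iff₀ (by positivity) (by positivity)]
    have : |3*b^2-v^2| ≤ 3 * (b^2+v^2) := by
      rw [abs_le]; constructor <;> nlinarith [sq_nonneg b, sq_nonneg v]
    calc _ ≤ 3 * (b^2+v^2) * (b^2+v^2)^2 := by gcongr
      _ = _ := by ring
  unfold GG
  calc _ ≤ _ := abs_add_le _ _
    _ ≤ 40 / (b^2+v^2)^2 + 6 * (3 / (b^2+v^2)^2) := by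
      rw [abs_mul, abs_of_pos (by positivity : 0 < Real.pi^2/3)]
      gcongr
    _ = 58 * (1 / (b^2+v^2)) * (1/(b^2+v^2)) := by field_simp; norm_num
    _ ≤ 58 * (1 / b^2) * (1/(1/4 * (1+v^2))) := by
      gcongr
      nlinarith [sq_nonneg v]
    _ = 232 * (1/b^2) * (1+v^2)⁻¹ := by field_simp; norm_num
    _ ≤ _ := by gcongr; norm_num

lemma GG_cont (b : ℝ) (hb : 0 < b) : Continuous (GG b) := by
  unfold GG
  have : ∀ v : ℝ, b^2+v^2 ≠ 0 := fun v => by positivity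
  refine Continuous.add (Continuous.div (by fun_prop) (by fun_prop) fun v => pow_ne_zero _ (this v))
    (Continuous.mul (by fun_prop) (Continuous.div (by fun_prop) (by fun_prop) fun v => pow_ne_zero _ (this v)))

lemma GG_int (b : ℝ) (hb : 1/2 ≤ b) : MeasureTheory.Integrable (GG b) := by
  refine (integrable_inv_one_add_sq.const_mul (1000 * (1/b^2))).mono'
    (GG_cont b (by linarith)).aestronglyMeasurable (Filter.Eventually.of_forall fun v => ?_)
  rw [Real.norm_eq_abs]
  exact GG_bound b v hb

lemma GG_integral (b : ℝ) (hb : 1/2 ≤ b) :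
    ∫ v in Set.Ioi (0:ℝ), GG b v = Real.pi/2 * (1/b^5 + Real.pi^2/3 * (1/b^3)) := by
  have hb0 : 0 < b := by linarith
  have hD : ∀ v : ℝ, b^2+v^2 ≠ 0 := fun v => by positivity
  let K : ℝ → ℝ := fun v => (1/b^5 + Real.pi^2/3 * (1/b^3)) * Real.arctan (v/b)
    + ((1/b^4 + Real.pi^2/3*(1/b^2)) * (v/(b^2+v^2)) + (1/b^2 + Real.pi^2/3) * (v/(b^2+v^2)^2)
      + (3*b^2*v-v^3)/(b^2+v^2)^3 * (1/(3*b^2)) + (b^2*v-v^3)/(b^2+v^2)^4)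
  have hderiv : ∀ v : ℝ, HasDerivAt K (GG b v) v := by
    intro v
    have hd : HasDerivAt (fun v : ℝ => b^2+v^2) (2*v) v := by
      simpa using (hasDerivAt_pow 2 v).const_add (b^2)
    have hi : HasDerivAt (fun v : ℝ => v) 1 v := hasDerivAt_id v
    have h1 := (hi.div_const b).arctan
    have h2 := hi.div hd (hD v)
    have h3 := hi.div (hd.pow 2) (pow_ne_zero _ (hD v))
    have h4 := ((hi.const_mul (3*b^2)).sub (hasDerivAt_pow 3 v)).div (hd.pow 3) (pow_ne_zero _ (hD v))
    have h5 := ((hi.const_mul (b^2)).sub (hasDerivAt_pow 3 v)).div (hd.pow 4) (pow_ne_zero _ (hD v))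
    have := (h1.const_mul (1/b^5 + Real.pi^2/3 * (1/b^3))).add
      ((((h2.const_mul (1/b^4 + Real.pi^2/3*(1/b^2))).add (h3.const_mul (1/b^2 + Real.pi^2/3))).add
        (h4.mul_const (1/(3*b^2)))).add h5)
    refine HasDerivAt.congr_deriv this ?_
    unfold GG
    have hD' := hD v
    have : 1 + (v/b)^2 = (b^2+v^2)/b^2 := by field_simp
    rw [this]
    simp only [Pi.pow_apply, Pi.sub_apply]
    push_cast
    field_simp
    ring
  have hlim : Filter.Tendsto K Filter.atTop (nhds ((1/b^5 + Real.pi^2/3 * (1/b^3)) * (Real.pi/2)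
     + ((1/b^4 + Real.pi^2/3*(1/b^2)) * 0 + (1/b^2 + Real.pi^2/3) * 0 + 0 * (1/(3*b^2)) + 0))) := by
    have hinv : Filter.Tendsto (fun v : ℝ => v⁻¹) Filter.atTop (nhds 0) := tendsto_inv_atTop_zero
    have bd : ∀ f : ℝ → ℝ, (∀ v, 1 ≤ v → |f v| ≤ 1000 * (1 + b^2) * v⁻¹) → Filter.Tendsto f Filter.atTop (nhds 0) := by
      intro f hf
      refine squeeze_zero_norm' (a := fun v => 1000 * (1 + b^2) * v⁻¹) ?_ (by simpa using hinv.const_mul (1000 * (1 + b^2)))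
      filter_upwards [Filter.eventually_ge_atTop 1] with v hv using hf v hv
    have hmain : ∀ k : ℕ, 1 ≤ k → ∀ p : ℝ → ℝ, (∀ v, 1 ≤ v → |p v| ≤ 1000 * (1+b^2) * v * (b^2+v^2)^(k-1)) →
        Filter.Tendsto (fun v => p v / (b^2+v^2)^k) Filter.atTop (nhds 0) := by
      intro k hk p hp
      apply bd
      intro v hv
      have hDp : 0 < b^2+v^2 := by positivity
      rw [abs_div, abs_of_pos (pow_pos hDp k), div_le_iff₀ (pow_pos hDp k)]
      obtain ⟨j, rfl⟩ : ∃ j, k = j+1 := ⟨k-1, by omega⟩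
      refine (hp v hv).trans ?_
      simp only [Nat.add_sub_cancel]
      have : v ≤ v⁻¹ * (b^2+v^2) := by
        rw [inv_mul_eq_div, le_div_iff₀ (by linarith)]; nlinarith
      calc _ ≤ 1000 * (1+b^2) * (v⁻¹ * (b^2+v^2)) * (b^2+v^2)^j := by gcongr
        _ = _ := by ring
    have g1 : ∀ v : ℝ, 1 ≤ v → 1 ≤ b^2+v^2 := fun v hv => by nlinarith
    refine Filter.Tendsto.add (Filter.Tendsto.const_mul _ ?_) (Filter.Tendsto.add (Filter.Tendsto.add (Filter.Tendsto.add
      (Filter.Tendsto.const_mul _ ?_) (Filter.Tendsto.const_mul _ ?_)) (Filter.Tendsto.mul_const _ ?_)) ?_)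
    · exact (Real.tendsto_arctan_atTop.mono_right nhdsWithin_le_nhds).comp (Filter.tendsto_id.atTop_div_const hb0)
    · have := hmain 1 le_rfl (fun v => v) (fun v hv => by
        rw [abs_of_pos (by linarith)]; simp; nlinarith [sq_nonneg b])
      simpa using this
    · refine hmain 2 (by norm_num) (fun v => v) (fun v hv => by
        rw [abs_of_pos (by linarith)]
        have := g1 v hv
        have h0 : 0 ≤ v := by linarith
        have : v * 1 ≤ (1000 * (1+b^2) * v) * (b^2+v^2)^(2-1) := by
          gcongr
          · nlinarith [sq_nonneg b]
          · simpa using this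
        linarith)
    · refine hmain 3 (by norm_num) (fun v => 3*b^2*v-v^3) (fun v hv => ?_)
      have := g1 v hv
      have h0 : 0 ≤ v := by linarith
      have e : |3*b^2*v-v^3| ≤ 3 * v * (b^2+v^2) := by
        have : 0 ≤ b^2*v := by positivity
        have : 0 ≤ v^3 := by positivity
        rw [abs_le]; constructor <;> nlinarith
      calc _ ≤ 3 * v * (b^2+v^2) := e
        _ ≤ 1000 * (1+b^2) * v * (b^2+v^2)^(3-1) := by
          gcongr
          · nlinarith [sq_nonneg b]
          · simp; nlinarith
    · refine hmain 4 (by norm_num) (fun v => b^2*v-v^3) (fun v hv => ?_)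
      have := g1 v hv
      have h0 : 0 ≤ v := by linarith
      have e : |b^2*v-v^3| ≤ 3 * v * (b^2+v^2) := by
        have : 0 ≤ b^2*v := by positivity
        have : 0 ≤ v^3 := by positivity
        rw [abs_le]; constructor <;> nlinarith
      calc _ ≤ 3 * v * (b^2+v^2) := e
        _ = 3 * v * (b^2+v^2)^1 := by ring
        _ ≤ 1000 * (1+b^2) * v * (b^2+v^2)^(4-1) := by
          gcongr
          · nlinarith [sq_nonneg b]
          · norm_num
  rw [MeasureTheory.integral_Ioi_of_hasDerivAt_of_tendsto' (fun v _ => hderiv v) (GG_int b hb).integrableOn hlim]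
  simp [K]
  ring

lemma sum_half (k : ℕ) (hk : 2 ≤ k) :
    HasSum (fun n : ℕ => 1 / ((n:ℝ) + 1/2)^k) ((2^k - 1) * ∑' m : ℕ, (1:ℝ) / ((m:ℝ)+1)^k) := by
  have hs : Summable (fun m : ℕ => (1:ℝ) / ((m:ℝ)+1)^k) := by
    have := (summable_nat_add_iff 1).mpr (Real.summable_one_div_nat_pow.mpr (by omega : 1 < k))
    simpa using this
  have h1 : ∀ n : ℕ, (1:ℝ) / (((2*n:ℕ):ℝ)+1)^k = 1/2^k * (1 / ((n:ℝ)+1/2)^k) := by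
    intro n
    rw [one_div_mul_one_div, ← mul_pow]; push_cast; ring_nf
  have h2 : ∀ n : ℕ, (1:ℝ) / (((2*n+1:ℕ):ℝ)+1)^k = 1/2^k * (1 / ((n:ℝ)+1)^k) := by
    intro n
    rw [one_div_mul_one_div, ← mul_pow]; push_cast; ring_nf
  have h2k : (2:ℝ)^k ≠ 0 := by positivity
  have inj0 : Function.Injective (fun n : ℕ => 2*n) := fun a b h => by
    dsimp only at h; omega
  have heven : Summable (fun n : ℕ => (1:ℝ)/2^k * (1 / ((n:ℝ)+1/2)^k)) :=
    (hs.comp_injective inj0).congr h1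
  have hsum : Summable (fun n : ℕ => 1 / ((n:ℝ) + 1/2)^k) := by
    refine (heven.mul_left (2^k)).congr fun n => ?_
    rw [← mul_assoc, mul_one_div_cancel h2k, one_mul]
  have hE : HasSum (fun n : ℕ => (1:ℝ) / (((2*n:ℕ):ℝ)+1)^k) (1/2^k * ∑' n : ℕ, 1 / ((n:ℝ) + 1/2)^k) := by
    rw [funext h1]; exact hsum.hasSum.mul_left _
  have hO : HasSum (fun n : ℕ => (1:ℝ) / (((2*n+1:ℕ):ℝ)+1)^k) (1/2^k * ∑' n : ℕ, (1:ℝ) / ((n:ℝ) + 1)^k) := by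
    rw [funext h2]; exact hs.hasSum.mul_left _
  have h := (HasSum.even_add_odd (f := fun m : ℕ => (1:ℝ) / ((m:ℝ)+1)^k) hE hO).tsum_eq
  have hf : ((2^k - 1) * ∑' m : ℕ, (1:ℝ) / ((m:ℝ)+1)^k) = ∑' n : ℕ, 1 / ((n:ℝ) + 1/2)^k := by
    generalize (∑' m : ℕ, (1:ℝ) / ((m:ℝ)+1)^k) = A at *
    generalize (∑' n : ℕ, 1 / ((n:ℝ) + 1/2)^k) = B at *
    generalize (2:ℝ)^k = C at *
    field_simp at h
    linarith
  rw [hf]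
  exact hsum.hasSum

/-- `∫₀^∞ sinh u / (u cosh⁵ u) du = (1/(3π²)) (7ζ(3) + 93ζ(5)/π²)`. -/
theorem integral_sinh_div_cosh_five :
    ∫ u in Set.Ioi (0 : ℝ), Real.sinh u / (u * Real.cosh u ^ 5) =
      (1 / (3 * Real.pi ^ 2)) *
        (7 * (∑' m : ℕ, (1 : ℝ) / ((m : ℝ) + 1) ^ 3) +
          93 * (∑' m : ℕ, (1 : ℝ) / ((m : ℝ) + 1) ^ 5) / Real.pi ^ 2) := by
  have hb : ∀ n : ℕ, (1/2 : ℝ) ≤ (n:ℝ) + 1/2 := fun n => by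
    have : (0:ℝ) ≤ n := n.cast_nonneg
    linarith
  have hsub := MeasureTheory.integral_comp_mul_left_Ioi' (fun u => Real.sinh u / (u * Real.cosh u ^ 5)) 0 Real.pi_pos
  rw [mul_zero] at hsub
  rw [← hsub, smul_eq_mul, ← MeasureTheory.integral_const_mul]
  have hcongr : ∫ v in Set.Ioi (0:ℝ), Real.pi * (Real.sinh (Real.pi * v) / (Real.pi * v * Real.cosh (Real.pi * v) ^ 5))
      = ∫ v in Set.Ioi (0:ℝ), ∑' n : ℕ, 2 / Real.pi^5 * GG (n + 1/2) v := by
    refine MeasureTheory.setIntegral_congr_fun measurableSet_Ioi fun v hv => ?_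
    have hv' : 0 < v := hv
    rw [(hasSum_GG v hv').tsum_eq]
    field_simp
  rw [hcongr]
  have key := MeasureTheory.hasSum_integral_of_summable_integral_norm
    (μ := MeasureTheory.volume.restrict (Set.Ioi (0:ℝ)))
    (F := fun (n : ℕ) v => 2 / Real.pi^5 * GG (n + 1/2) v)
    (fun n => ((GG_int _ (hb n)).const_mul _).integrableOn) ?_
  · have e : ∀ n : ℕ, ∫ v in Set.Ioi (0:ℝ), 2 / Real.pi^5 * GG (n + 1/2) v
        = 2 / Real.pi^5 * (Real.pi/2 * (1/((n:ℝ)+1/2)^5 + Real.pi^2/3 * (1/((n:ℝ)+1/2)^3))) := fun n => by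
      rw [MeasureTheory.integral_const_mul, GG_integral _ (hb n)]
    rw [funext e] at key
    have k2 := (((sum_half 5 (by norm_num)).add ((sum_half 3 (by norm_num)).mul_left (Real.pi^2/3))).mul_left (Real.pi/2)).mul_left (2/Real.pi^5)
    rw [key.unique k2]
    field_simp
    ring
  · refine Summable.of_nonneg_of_le (fun n => MeasureTheory.integral_nonneg fun v => norm_nonneg _) (fun n => ?_)
      ((sum_half 2 le_rfl).summable.mul_left (2/Real.pi^5 * 1000 * ∫ v in Set.Ioi (0:ℝ), (1+v^2)⁻¹))
    calc _ ≤ ∫ v in Set.Ioi (0:ℝ), (2/Real.pi^5 * 1000 * (1/((n:ℝ)+1/2)^2)) * (1+v^2)⁻¹ := by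
          refine MeasureTheory.integral_mono ((GG_int _ (hb n)).const_mul _).integrableOn.norm
            (integrable_inv_one_add_sq.const_mul _).integrableOn fun v => ?_
          simp only [norm_mul, Real.norm_eq_abs (GG _ _)]
          rw [Real.norm_of_nonneg (by positivity)]
          calc _ ≤ 2/Real.pi^5 * (1000 * (1/((n:ℝ)+1/2)^2) * (1+v^2)⁻¹) := by
                gcongr; exact GG_bound _ _ (hb n)
            _ = _ := by ring
      _ = _ := by rw [MeasureTheory.integral_const_mul]; ring
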